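/- arXiv:2302.05497 — 7 statements merged into one kernel-verified Lean document; each statement's English description precedes it below -/
import Mathlib

section
/- Let B ⊆ V be r-absorbing and let A be a proper subset of B. If λ^B(i) ≤ 0 for every i ∈ B∖A, then A is r-absorbing. -/
open Finset

section ZRP

variable {V : Type*} [Fintype V] [DecidableEq V]

/-- Irreducibility of a set of transition rates. -/
def IrreducibleRates (r : V → V → ℝ) : Prop :=
  ∀ i j : V, i ≠ j → ∃ (m : ℕ) (k : ℕ → V), k 0 = i ∧ k m = j ∧ ∀ l < m, 0 < r (k l) (k (l + 1))

/-- `ind A j` plays the role of the vector `1^A_j`: it equals the indicator of `{j}` on `A`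
and is harmonic (for the generator of `r`) at every point outside `A`. -/
def IsHarmFamily (r : V → V → ℝ) (ind : Finset V → V → V → ℝ) : Prop :=
  ∀ (A : Finset V), ∀ j ∈ A,
    (∀ i ∈ A, ind A j i = if i = j then (1 : ℝ) else 0) ∧
    (∀ k, k ∉ A → ∑ l, r k l * (ind A j l - ind A j k) = 0)

/-- The trace rates `r^A(i,j) = r(i,j) + ∑_{k∉A} r(i,k)·1^A_j(k)` (for `i ≠ j`). -/
noncomputable def traceRate (r : V → V → ℝ) (ind : Finset V → V → V → ℝ)
    (A : Finset V) (i j : V) : ℝ :=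
  if i = j then 0 else r i j + ∑ k ∈ Aᶜ, r i k * ind A j k

/-- `λ^A(i) = ∑_{j∈A} (r^A(j,i) − r^A(i,j))`. -/
noncomputable def lamA (r : V → V → ℝ) (ind : Finset V → V → V → ℝ)
    (A : Finset V) (i : V) : ℝ :=
  ∑ j ∈ A, (traceRate r ind A j i - traceRate r ind A i j)

/-- `A` is `r`-absorbing if `A = V` or `λ^{A∪{j}}(j) ≤ 0` for every `j ∉ A`. -/
def IsAbsorbing (r : V → V → ℝ) (ind : Finset V → V → V → ℝ) (A : Finset V) : Prop :=
  A = Finset.univ ∨ ∀ j ∉ A, lamA r ind (insert j A) j ≤ 0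

/-- The support `𝒮(u) = {i : u i > 0}`. -/
noncomputable def suppF (u : V → ℝ) : Finset V :=
  open scoped Classical in Finset.univ.filter (fun i => 0 < u i)

/-- `𝒜(S)`: the intersection of all `r`-absorbing subsets of `V` containing `S`. -/
noncomputable def minAbs (r : V → V → ℝ) (ind : Finset V → V → V → ℝ) (S : Finset V) :
    Finset V :=
  open scoped Classical in
  Finset.univ.filter (fun i => ∀ A : Finset V, IsAbsorbing r ind A → S ⊆ A → i ∈ A)

/-- The vector `v_i = ∑_k r(i,k)(1_{k} − 1_{i})`. -/
noncomputable def vvec (r : V → V → ℝ) (i : V) : V → ℝ :=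
  fun l => ∑ k, r i k * ((if l = k then (1 : ℝ) else 0) - (if l = i then (1 : ℝ) else 0))

/-- The vector `λ(j) = ∑_i (r(i,j) − r(j,i))`. -/
noncomputable def lamV (r : V → V → ℝ) : V → ℝ := fun j => ∑ i, (r i j - r j i)

/-- Membership in `D_B`: `f` is `C¹` on an open set containing the simplex and
`⟨∇f(u), v_i⟩ = 0` whenever `u ∈ Σ`, `u i = 0`, for every `i ∈ B`. -/
def MemD (r : V → V → ℝ) (B : Finset V) (f : (V → ℝ) → ℝ) : Prop :=
  (∃ U : Set (V → ℝ), IsOpen U ∧ stdSimplex ℝ V ⊆ U ∧ ContDiffOn ℝ 1 f U) ∧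
  ∀ i ∈ B, ∀ u ∈ stdSimplex ℝ V, u i = 0 → fderiv ℝ f u (vvec r i) = 0

/-- Condition (A). -/
def CondA (r : V → V → ℝ) (ζ : ℝ → V → ℝ) : Prop :=
  ∀ f : (V → ℝ) → ℝ, MemD r Finset.univ f → ∀ t : ℝ, 0 ≤ t →
    f (ζ t) = f (ζ 0) + ∫ s in (0:ℝ)..t, fderiv ℝ f (ζ s) (lamV r)

/-- A continuous path in the simplex (for nonnegative times). -/
def IsPath (ζ : ℝ → V → ℝ) : Prop :=
  ContinuousOn ζ (Set.Ici 0) ∧ ∀ t : ℝ, 0 ≤ t → ζ t ∈ stdSimplex ℝ V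

/-- `Σ_abs`: the configurations whose support is `r`-absorbing. -/
def SigmaAbs (r : V → V → ℝ) (ind : Finset V → V → V → ℝ) : Set (V → ℝ) :=
  {u | u ∈ stdSimplex ℝ V ∧ IsAbsorbing r ind (suppF u)}

/-- Condition (B): `inf{t ≥ 0 : ζ_t ∈ Σ_abs} = 0`. -/
def CondB (r : V → V → ℝ) (ind : Finset V → V → V → ℝ) (ζ : ℝ → V → ℝ) : Prop :=
  ∀ ε : ℝ, 0 < ε → ∃ t : ℝ, 0 ≤ t ∧ t < ε ∧ ζ t ∈ SigmaAbs r ind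

end ZRP

section Harmonic

variable {V : Type*} [Fintype V] {r : V → V → ℝ}
  {ind : Finset V → V → V → ℝ}

/-- The generator `L w(k) = ∑_l r(k,l)(w(l) − w(k))`. -/
def generator (r : V → V → ℝ) (w : V → ℝ) (k : V) : ℝ :=
  ∑ l, r k l * (w l - w k)

lemma generator_sub (w z : V → ℝ) (k : V) :
    generator r (fun l => w l - z l) k = generator r w k - generator r z k := by
  simp only [generator, ← Finset.sum_sub_distrib]
  exact Finset.sum_congr rfl fun l _ => by ring

lemma generator_linearCombination (s : Finset V) (c : V → ℝ) (w : V → V → ℝ) (k : V) :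
    generator r (fun l => ∑ i ∈ s, c i * w i l) k = ∑ i ∈ s, c i * generator r (w i) k := by
  simp only [generator, ← Finset.sum_sub_distrib, Finset.mul_sum]
  rw [Finset.sum_comm]
  exact Finset.sum_congr rfl fun i _ => Finset.sum_congr rfl fun l _ => by ring

/-- Minimum principle. -/
lemma nonneg_of_harmonic_off (hr : ∀ i j, 0 ≤ r i j) (hirr : IrreducibleRates r)
    {A : Finset V} (hA : A.Nonempty) {w : V → ℝ} (hw : ∀ i ∈ A, 0 ≤ w i)
    (hharm : ∀ k ∉ A, generator r w k = 0) (i : V) : 0 ≤ w i := by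
  obtain ⟨a, ha⟩ := hA
  obtain ⟨x, -, hx⟩ := Finset.exists_min_image univ w ⟨a, mem_univ a⟩
  by_contra! hi
  have hxneg : w x < 0 := (hx i (mem_univ i)).trans_lt hi
  have step : ∀ k l, w k = w x → 0 < r k l → w l = w x := by
    intro k l hk hkl
    have hkA : k ∉ A := fun h => (hw k h).not_gt (hk ▸ hxneg)
    have hterm := (Finset.sum_eq_zero_iff_of_nonneg fun l _ => mul_nonneg (hr k l)
      (sub_nonneg.2 (hk ▸ hx l (mem_univ l)))).1 (hharm k hkA) l (mem_univ l)
    rcases mul_eq_zero.1 hterm with h | h <;> linarith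
  have hxa : x ≠ a := fun h => (hw a ha).not_gt (h ▸ hxneg)
  obtain ⟨m, p, hp0, hpm, hp⟩ := hirr x a hxa
  have hpath : ∀ n ≤ m, w (p n) = w x := by
    intro n
    induction n with
    | zero => intro _; rw [hp0]
    | succ n ih => intro hn; exact step _ _ (ih (by lia)) (hp n (by lia))
  have := hpath m le_rfl
  rw [hpm] at this
  exact (hw a ha).not_gt (this ▸ hxneg)

lemma eq_of_harmonic_off (hr : ∀ i j, 0 ≤ r i j) (hirr : IrreducibleRates r)
    {A : Finset V} (hA : A.Nonempty) {w z : V → ℝ} (hwz : ∀ i ∈ A, w i = z i)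
    (hw : ∀ k ∉ A, generator r w k = 0) (hz : ∀ k ∉ A, generator r z k = 0) (i : V) :
    w i = z i := by
  have h1 := nonneg_of_harmonic_off hr hirr hA (w := fun l => w l - z l)
    (fun i hi => by simp [hwz i hi])
    (fun k hk => by rw [generator_sub, hw k hk, hz k hk, sub_zero]) i
  have h2 := nonneg_of_harmonic_off hr hirr hA (w := fun l => z l - w l)
    (fun i hi => by simp [hwz i hi])
    (fun k hk => by rw [generator_sub, hw k hk, hz k hk, sub_zero]) i
  linarith

namespace IsHarmFamily

variable [DecidableEq V] {A B : Finset V}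

lemma apply_of_mem (hind : IsHarmFamily r ind) {i j : V} (hj : j ∈ A) (hi : i ∈ A) :
    ind A j i = if i = j then 1 else 0 :=
  (hind A j hj).1 i hi

lemma generator_eq_zero (hind : IsHarmFamily r ind) {j k : V} (hj : j ∈ A) (hk : k ∉ A) :
    generator r (ind A j) k = 0 :=
  (hind A j hj).2 k hk

lemma nonneg (hind : IsHarmFamily r ind) (hr : ∀ i j, 0 ≤ r i j)
    (hirr : IrreducibleRates r) {j : V} (hj : j ∈ A) (i : V) : 0 ≤ ind A j i :=
  nonneg_of_harmonic_off hr hirr ⟨j, hj⟩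
    (fun i hi => by rw [hind.apply_of_mem hj hi]; split_ifs <;> norm_num)
    (fun k hk => hind.generator_eq_zero hj hk) i

/-- A vector harmonic off `B` is determined by its values on `B`. -/
lemma eq_sum_of_harmonic_off (hind : IsHarmFamily r ind) (hr : ∀ i j, 0 ≤ r i j)
    (hirr : IrreducibleRates r) (hB : B.Nonempty) {w : V → ℝ}
    (hw : ∀ k ∉ B, generator r w k = 0) (l : V) :
    w l = ∑ i ∈ B, w i * ind B i l := by
  refine eq_of_harmonic_off hr hirr hB (z := fun l => ∑ i ∈ B, w i * ind B i l) ?_ hw ?_ l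
  · intro i hi
    rw [Finset.sum_congr rfl fun j hj => by rw [hind.apply_of_mem hj hi]]
    simp [hi]
  · intro k hk
    rw [generator_linearCombination]
    exact Finset.sum_eq_zero fun i hi => by rw [hind.generator_eq_zero hi hk, mul_zero]

lemma sum_eq_one (hind : IsHarmFamily r ind) (hr : ∀ i j, 0 ≤ r i j)
    (hirr : IrreducibleRates r) (hA : A.Nonempty) (l : V) : ∑ i ∈ A, ind A i l = 1 := by
  have := hind.eq_sum_of_harmonic_off hr hirr hA (w := fun _ => 1)
    (fun k _ => by simp [generator]) l
  simpa using this.symm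

lemma le_one (hind : IsHarmFamily r ind) (hr : ∀ i j, 0 ≤ r i j)
    (hirr : IrreducibleRates r) {j : V} (hj : j ∈ A) (i : V) : ind A j i ≤ 1 := by
  rw [← hind.sum_eq_one hr hirr ⟨j, hj⟩ i]
  exact Finset.single_le_sum (f := fun k => ind A k i)
    (fun k hk => hind.nonneg hr hirr hk i) hj

lemma traceRate_eq_generator (hind : IsHarmFamily r ind) {i j : V} (hi : i ∈ A) (hj : j ∈ A)
    (hij : i ≠ j) : traceRate r ind A i j = generator r (ind A j) i := by
  have h : ∑ l ∈ A, r i l * ind A j l = r i j := by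
    rw [Finset.sum_congr rfl fun l hl => by rw [hind.apply_of_mem hj hl]]
    simp [hj]
  rw [traceRate, if_neg hij, generator, hind.apply_of_mem hj hi, if_neg hij, ← h,
    Finset.sum_add_sum_compl]
  simp

lemma sum_generator_eq_zero (hind : IsHarmFamily r ind) (hr : ∀ i j, 0 ≤ r i j)
    (hirr : IrreducibleRates r) (hA : A.Nonempty) (k : V) : ∑ i ∈ A, generator r (ind A i) k = 0 := by
  have h := generator_linearCombination (r := r) A (fun _ => 1) (ind A) k
  simp only [one_mul] at h
  rw [← h]
  simp [generator, hind.sum_eq_one hr hirr hA]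

lemma lamA_eq_sum_generator (hind : IsHarmFamily r ind) (hr : ∀ i j, 0 ≤ r i j)
    (hirr : IrreducibleRates r) {j : V} (hj : j ∈ A) :
    lamA r ind A j = ∑ k, generator r (ind A j) k := by
  have hout : ∑ k ∈ Aᶜ, generator r (ind A j) k = 0 :=
    Finset.sum_eq_zero fun k hk => hind.generator_eq_zero hj (Finset.mem_compl.1 hk)
  have hzero := hind.sum_generator_eq_zero hr hirr ⟨j, hj⟩ j
  rw [← Finset.add_sum_erase _ _ hj] at hzero
  rw [← Finset.sum_add_sum_compl A, hout, add_zero, lamA, ← Finset.add_sum_erase _ _ hj,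
    ← Finset.add_sum_erase _ _ hj, sub_self, zero_add, Finset.sum_sub_distrib,
    eq_neg_of_add_eq_zero_left hzero,
    Finset.sum_congr rfl fun i hi => hind.traceRate_eq_generator
      (Finset.mem_of_mem_erase hi) hj (Finset.ne_of_mem_erase hi),
    Finset.sum_congr rfl fun i hi => hind.traceRate_eq_generator hj
      (Finset.mem_of_mem_erase hi) (Finset.ne_of_mem_erase hi).symm]
  ring

/-- Consistency of the drifts of successive traces. -/
lemma lamA_eq_sum (hind : IsHarmFamily r ind) (hr : ∀ i j, 0 ≤ r i j)
    (hirr : IrreducibleRates r) (hAB : A ⊆ B) {j : V} (hj : j ∈ A) :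
    lamA r ind A j = ∑ i ∈ B, ind A j i * lamA r ind B i := by
  have h : ind A j = fun l => ∑ i ∈ B, ind A j i * ind B i l :=
    funext fun l => hind.eq_sum_of_harmonic_off hr hirr ⟨j, hAB hj⟩
      (fun k hk => hind.generator_eq_zero hj fun hkA => hk (hAB hkA)) l
  calc lamA r ind A j = ∑ k, generator r (ind A j) k := hind.lamA_eq_sum_generator hr hirr hj
    _ = ∑ k, ∑ i ∈ B, ind A j i * generator r (ind B i) k :=
      Finset.sum_congr rfl fun k _ => by
        conv_lhs => rw [h]
        exact generator_linearCombination B (ind A j) (ind B) k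
    _ = ∑ i ∈ B, ind A j i * lamA r ind B i := by
      rw [Finset.sum_comm]
      exact Finset.sum_congr rfl fun i hi => by
        rw [hind.lamA_eq_sum_generator hr hirr hi, Finset.mul_sum]

lemma apply_insert_of_mem (hind : IsHarmFamily r ind) {i j : V} (hjA : j ∉ A) (hi : i ∈ A) :
    ind (insert j A) j i = 0 := by
  rw [hind.apply_of_mem (mem_insert_self j A) (mem_insert_of_mem hi), if_neg]
  rintro rfl
  exact hjA hi

lemma lamA_insert_nonpos_of_mem (hind : IsHarmFamily r ind) (hr : ∀ i j, 0 ≤ r i j)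
    (hirr : IrreducibleRates r) (hAB : A ⊆ B)
    (hlam : ∀ i ∈ B \ A, lamA r ind B i ≤ 0) {j : V} (hjB : j ∈ B)
    (hjA : j ∉ A) : lamA r ind (insert j A) j ≤ 0 := by
  rw [hind.lamA_eq_sum hr hirr (Finset.insert_subset hjB hAB) (mem_insert_self j A)]
  refine Finset.sum_nonpos fun i hi => ?_
  by_cases hiA : i ∈ A
  · rw [hind.apply_insert_of_mem hjA hiA, zero_mul]
  · exact mul_nonpos_of_nonneg_of_nonpos (hind.nonneg hr hirr (mem_insert_self j A) i)
      (hlam i (mem_sdiff.2 ⟨hi, hiA⟩))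

lemma lamA_eq_lamA_insert_add (hind : IsHarmFamily r ind) (hr : ∀ i j, 0 ≤ r i j)
    (hirr : IrreducibleRates r) {i j : V} (hi : i ∈ B) (hj : j ∉ B) :
    lamA r ind B i =
      lamA r ind (insert j B) i + ind B i j * lamA r ind (insert j B) j := by
  rw [hind.lamA_eq_sum hr hirr (Finset.subset_insert j B) hi, Finset.sum_insert hj,
    Finset.sum_congr rfl fun k hk => by rw [hind.apply_of_mem hi hk]]
  simp only [ite_mul, one_mul, zero_mul, Finset.sum_ite_eq', if_pos hi]
  ring

lemma lamA_insert_nonpos_of_notMem (hind : IsHarmFamily r ind) (hr : ∀ i j, 0 ≤ r i j)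
    (hirr : IrreducibleRates r) (hAB : A ⊂ B)
    (hlam : ∀ i ∈ B \ A, lamA r ind B i ≤ 0) {j : V} (hjB : j ∉ B)
    (hj : lamA r ind (insert j B) j ≤ 0) : lamA r ind (insert j A) j ≤ 0 := by
  have hjA : j ∉ A := fun h => hjB (hAB.subset h)
  have hjC : j ∈ insert j A := mem_insert_self j A
  have hB : B.Nonempty := (Finset.empty_subset A).trans_ssubset hAB |> Finset.empty_ssubset.1
  have hterm : ∀ i ∈ B, ind (insert j A) j i * lamA r ind (insert j B) i ≤
      -(ind B i j * lamA r ind (insert j B) j) := by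
    intro i hi
    have hBi := mul_nonpos_of_nonneg_of_nonpos (hind.nonneg hr hirr hi j) hj
    by_cases hiA : i ∈ A
    · rw [hind.apply_insert_of_mem hjA hiA]
      linarith
    · have hdrift := hind.lamA_eq_lamA_insert_add hr hirr hi hjB
      have hle := hlam i (mem_sdiff.2 ⟨hi, hiA⟩)
      have h0 := hind.nonneg hr hirr hjC i
      have h1 := hind.le_one hr hirr hjC i
      calc ind (insert j A) j i * lamA r ind (insert j B) i
          ≤ ind (insert j A) j i * -(ind B i j * lamA r ind (insert j B) j) :=
            mul_le_mul_of_nonneg_left (by linarith) h0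
        _ ≤ _ := mul_le_of_le_one_left (by linarith) h1
  rw [hind.lamA_eq_sum hr hirr (Finset.insert_subset_insert j hAB.subset) hjC,
    Finset.sum_insert hjB, hind.apply_of_mem hjC hjC, if_pos rfl, one_mul]
  have hsum := Finset.sum_le_sum hterm
  rw [Finset.sum_neg_distrib, ← Finset.sum_mul, hind.sum_eq_one hr hirr hB] at hsum
  linarith

end IsHarmFamily

end Harmonic

/-- If `B` is `r`-absorbing, `A ⊊ B`, and `λ^B(i) ≤ 0` for every `i ∈ B∖A`,
then `A` is `r`-absorbing. -/
theorem absorbing_of_subset (V : Type*) [Fintype V] [DecidableEq V] [Nonempty V]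
    (r : V → V → ℝ) (hr_nonneg : ∀ i j, 0 ≤ r i j) (hr_diag : ∀ i, r i i = 0)
    (hr_irr : IrreducibleRates r)
    (ind : Finset V → V → V → ℝ) (hind : IsHarmFamily r ind)
    (A B : Finset V) (hB : IsAbsorbing r ind B) (hAB : A ⊂ B)
    (hlam : ∀ i ∈ B \ A, lamA r ind B i ≤ 0) :
    IsAbsorbing r ind A := by
  refine Or.inr fun j hjA => ?_
  by_cases hjB : j ∈ B
  · exact hind.lamA_insert_nonpos_of_mem hr_nonneg hr_irr hAB.subset hlam hjB hjA
  · refine hind.lamA_insert_nonpos_of_notMem hr_nonneg hr_irr hAB hlam hjB ?_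
    rcases hB with rfl | hB
    · exact absurd (mem_univ j) hjB
    · exact hB j hjB
end

section
/- For every nonempty S ⊆ V, let 𝒜(S) denote the intersection of all r-absorbing subsets of V containing S. Then 𝒜(S) is r-absorbing, contains S, and satisfies λ^{𝒜(S)}(i) > 0 for every i ∈ 𝒜(S)∖S; moreover it is the unique such set: if A is r-absorbing, S ⊆ A, and λ^A(i) > 0 for every i ∈ A∖S, then A = 𝒜(S). -/
open Finset

section TraceRates

variable {V : Type*} [Fintype V] {r : V → V → ℝ} {ind : Finset V → V → V → ℝ} {A B D S : Finset V}

/-- Maximum principle for vectors that are harmonic off a nonempty set. -/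
theorem harmonic_nonpos (hr : ∀ i j, 0 ≤ r i j) (hirr : IrreducibleRates r)
    (hA : A.Nonempty) {f : V → ℝ} (hf : ∀ k, k ∉ A → ∑ l, r k l * (f l - f k) = 0)
    (hfA : ∀ i ∈ A, f i ≤ 0) (i : V) : f i ≤ 0 := by
  obtain ⟨a, ha⟩ := hA
  obtain ⟨i₀, -, hmax⟩ := Finset.exists_max_image univ f ⟨a, mem_univ a⟩
  by_contra! hi
  have hpos : 0 < f i₀ := hi.trans_le (hmax i (mem_univ i))
  have hne : i₀ ≠ a := by
    rintro rfl
    exact absurd (hfA _ ha) (not_le.mpr hpos)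
  obtain ⟨m, k, hk0, hkm, hk⟩ := hirr i₀ a hne
  have hconst : ∀ l ≤ m, f (k l) = f i₀ := by
    intro l
    induction l with
    | zero => intro _; rw [hk0]
    | succ l ih =>
      intro hl
      have hfl := ih (by lia)
      have hnot : k l ∉ A := fun h => absurd (hfA _ h) (by rw [hfl]; exact not_le.mpr hpos)
      have hle : ∀ x ∈ univ, r (k l) x * (f x - f (k l)) ≤ 0 := fun x _ =>
        mul_nonpos_of_nonneg_of_nonpos (hr _ _) (by linarith [hmax x (mem_univ x)])
      have hzero := (Finset.sum_eq_zero_iff_of_nonpos hle).mp (hf _ hnot) (k (l + 1)) (mem_univ _)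
      rcases mul_eq_zero.mp hzero with h | h
      · exact absurd h (hk l (by lia)).ne'
      · linarith
  have := hconst m le_rfl
  rw [hkm] at this
  linarith [hfA a ha]

/-- Two vectors that are harmonic off a nonempty set and agree on it are equal. -/
theorem harmonic_ext (hr : ∀ i j, 0 ≤ r i j) (hirr : IrreducibleRates r)
    (hA : A.Nonempty) {f g : V → ℝ} (hf : ∀ k, k ∉ A → ∑ l, r k l * (f l - f k) = 0)
    (hg : ∀ k, k ∉ A → ∑ l, r k l * (g l - g k) = 0) (hfg : ∀ i ∈ A, f i = g i) : f = g := by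
  have key : ∀ f g : V → ℝ, (∀ k, k ∉ A → ∑ l, r k l * (f l - f k) = 0) →
      (∀ k, k ∉ A → ∑ l, r k l * (g l - g k) = 0) → (∀ i ∈ A, f i = g i) →
      ∀ i, f i ≤ g i := by
    intro f g hf hg hfg i
    refine sub_nonpos.mp (harmonic_nonpos hr hirr hA (f := fun x => f x - g x) ?_ ?_ i)
    · intro k hk
      have := congrArg₂ (· - ·) (hf k hk) (hg k hk)
      simp only [← Finset.sum_sub_distrib, sub_zero] at this
      rw [← this]
      exact Finset.sum_congr rfl fun l _ => by ring
    · intro i hi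
      simp [hfg i hi]
  funext i
  exact le_antisymm (key f g hf hg hfg i) (key g f hg hf (fun i hi => (hfg i hi).symm) i)

variable [DecidableEq V]

theorem sum_mul_ind_harmonic (hind : IsHarmFamily r ind) (c : V → ℝ) {k : V} (hk : k ∉ A) :
    ∑ l, r k l * (∑ j ∈ A, c j * ind A j l - ∑ j ∈ A, c j * ind A j k) = 0 := by
  calc ∑ l, r k l * (∑ j ∈ A, c j * ind A j l - ∑ j ∈ A, c j * ind A j k)
      = ∑ l, ∑ j ∈ A, c j * (r k l * (ind A j l - ind A j k)) := by
        refine Finset.sum_congr rfl fun l _ => ?_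
        rw [← Finset.sum_sub_distrib, Finset.mul_sum]
        exact Finset.sum_congr rfl fun j _ => by ring
    _ = ∑ j ∈ A, c j * ∑ l, r k l * (ind A j l - ind A j k) := by
        rw [Finset.sum_comm]
        simp only [Finset.mul_sum]
    _ = 0 := Finset.sum_eq_zero fun j hj => by rw [(hind A j hj).2 k hk, mul_zero]

theorem sum_mul_ind_apply (hind : IsHarmFamily r ind) (c : V → ℝ) {i : V} (hi : i ∈ A) :
    ∑ j ∈ A, c j * ind A j i = c i := by
  rw [Finset.sum_congr rfl fun j hj => by rw [(hind A j hj).1 i hi]]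
  simp [hi]

/-- A vector harmonic off `A` is the combination of the `1^A_j` given by its values on `A`. -/
theorem eq_sum_mul_ind (hr : ∀ i j, 0 ≤ r i j) (hirr : IrreducibleRates r)
    (hind : IsHarmFamily r ind) (hA : A.Nonempty) {f : V → ℝ}
    (hf : ∀ k, k ∉ A → ∑ l, r k l * (f l - f k) = 0) (i : V) :
    f i = ∑ j ∈ A, f j * ind A j i :=
  congrFun (harmonic_ext hr hirr hA hf (g := fun i => ∑ j ∈ A, f j * ind A j i)
    (fun _ hk => sum_mul_ind_harmonic hind f hk)
    (fun _ hi => (sum_mul_ind_apply hind f hi).symm)) i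

theorem sum_ind (hr : ∀ i j, 0 ≤ r i j) (hirr : IrreducibleRates r)
    (hind : IsHarmFamily r ind) (hA : A.Nonempty) (i : V) : ∑ j ∈ A, ind A j i = 1 := by
  simpa using (eq_sum_mul_ind hr hirr hind hA (f := fun _ => (1 : ℝ)) (by simp) i).symm

theorem ind_nonneg (hr : ∀ i j, 0 ≤ r i j) (hirr : IrreducibleRates r)
    (hind : IsHarmFamily r ind) {j : V} (hj : j ∈ A) (i : V) : 0 ≤ ind A j i := by
  refine neg_nonpos.mp (harmonic_nonpos hr hirr ⟨j, hj⟩ (f := fun x => -ind A j x) ?_ ?_ i)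
  · intro k hk
    rw [← neg_eq_zero, ← (hind A j hj).2 k hk, ← Finset.sum_neg_distrib]
    exact Finset.sum_congr rfl fun l _ => by ring
  · intro i hi
    rw [(hind A j hj).1 i hi]
    split_ifs <;> simp

theorem ind_le_one (hr : ∀ i j, 0 ≤ r i j) (hirr : IrreducibleRates r)
    (hind : IsHarmFamily r ind) {j : V} (hj : j ∈ A) (i : V) : ind A j i ≤ 1 := by
  rw [← sum_ind hr hirr hind ⟨j, hj⟩ i]
  exact Finset.single_le_sum (f := fun j => ind A j i)
    (fun k hk => ind_nonneg hr hirr hind hk i) hj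

theorem traceRate_eq_sum (hind : IsHarmFamily r ind) {i j : V} (hj : j ∈ A) (hij : i ≠ j) :
    traceRate r ind A i j = ∑ k, r i k * ind A j k := by
  rw [traceRate, if_neg hij, ← Finset.sum_add_sum_compl A]
  congr 1
  rw [Finset.sum_congr rfl fun k hk => by rw [(hind A j hj).1 k hk]]
  simp [hj]

/-- `λ^A(i) = ∑_j L 1^A_i(j)`. -/
theorem lamA_eq_sum (hr : ∀ i j, 0 ≤ r i j) (hirr : IrreducibleRates r)
    (hind : IsHarmFamily r ind) {i : V} (hi : i ∈ A) :
    lamA r ind A i = ∑ j, ∑ k, r j k * (ind A i k - ind A i j) := by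
  have hout : ∑ j ∈ Aᶜ, ∑ k, r j k * (ind A i k - ind A i j) = 0 :=
    Finset.sum_eq_zero fun j hj => (hind A i hi).2 j (Finset.mem_compl.mp hj)
  rw [← Finset.sum_add_sum_compl A, hout, add_zero, lamA, Finset.sum_sub_distrib,
    ← Finset.add_sum_erase A (fun j => traceRate r ind A j i) hi,
    ← Finset.add_sum_erase A (fun j => traceRate r ind A i j) hi,
    ← Finset.add_sum_erase A (fun j => ∑ k, r j k * (ind A i k - ind A i j)) hi]
  have hdiag : traceRate r ind A i i = 0 := by simp [traceRate]
  have hin : ∑ j ∈ A.erase i, traceRate r ind A j i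
      = ∑ j ∈ A.erase i, ∑ k, r j k * (ind A i k - ind A i j) := by
    refine Finset.sum_congr rfl fun j hj => ?_
    obtain ⟨hji, hjA⟩ := Finset.mem_erase.mp hj
    rw [traceRate_eq_sum hind hi hji, (hind A i hi).1 j hjA, if_neg hji]
    simp
  have hex : ∑ j ∈ A.erase i, traceRate r ind A i j
      = -∑ k, r i k * (ind A i k - ind A i i) := by
    rw [Finset.sum_congr rfl fun j hj => traceRate_eq_sum hind (Finset.mem_of_mem_erase hj)
      (Finset.ne_of_mem_erase hj).symm, Finset.sum_comm, ← Finset.sum_neg_distrib]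
    refine Finset.sum_congr rfl fun k _ => ?_
    have h1 := sum_ind hr hirr hind ⟨i, hi⟩ k
    rw [← Finset.add_sum_erase A _ hi] at h1
    rw [← Finset.mul_sum, (hind A i hi).1 i hi, if_pos rfl, ← h1]
    ring
  rw [hdiag, hin, hex]
  ring

/-- Consistency of the drifts of nested traces. -/
theorem lamA_eq_sum_lamA (hr : ∀ i j, 0 ≤ r i j) (hirr : IrreducibleRates r)
    (hind : IsHarmFamily r ind) (hBA : B ⊆ A) {i : V} (hi : i ∈ B) :
    lamA r ind B i = ∑ j ∈ A, ind B i j * lamA r ind A j := by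
  have hrep : ∀ k, ind B i k = ∑ j ∈ A, ind B i j * ind A j k :=
    eq_sum_mul_ind hr hirr hind ⟨i, hBA hi⟩
      fun k hk => (hind B i hi).2 k fun h => hk (hBA h)
  calc lamA r ind B i = ∑ x, ∑ k, r x k * (ind B i k - ind B i x) :=
        lamA_eq_sum hr hirr hind hi
    _ = ∑ x, ∑ k, ∑ j ∈ A, ind B i j * (r x k * (ind A j k - ind A j x)) := by
        refine Finset.sum_congr rfl fun x _ => Finset.sum_congr rfl fun k _ => ?_
        rw [hrep k, hrep x, ← Finset.sum_sub_distrib, Finset.mul_sum]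
        exact Finset.sum_congr rfl fun j _ => by ring
    _ = ∑ j ∈ A, ∑ x, ∑ k, ind B i j * (r x k * (ind A j k - ind A j x)) := by
        simp only [Finset.sum_comm (s := univ) (t := A)]
    _ = ∑ j ∈ A, ind B i j * lamA r ind A j := by
        refine Finset.sum_congr rfl fun j hj => ?_
        rw [lamA_eq_sum hr hirr hind hj]
        simp only [Finset.mul_sum]

theorem lamA_eq_add_sum_sdiff (hr : ∀ i j, 0 ≤ r i j) (hirr : IrreducibleRates r)
    (hind : IsHarmFamily r ind) (hBA : B ⊆ A) {i : V} (hi : i ∈ B) :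
    lamA r ind B i = lamA r ind A i + ∑ j ∈ A \ B, ind B i j * lamA r ind A j := by
  rw [lamA_eq_sum_lamA hr hirr hind hBA hi, ← Finset.sum_sdiff hBA, add_comm]
  congr 1
  rw [Finset.sum_congr rfl fun j hj => by rw [(hind B i hi).1 j hj]]
  simp [hi]

theorem lamA_erase (hr : ∀ i j, 0 ≤ r i j) (hirr : IrreducibleRates r)
    (hind : IsHarmFamily r ind) {i j : V} (hj : j ∈ A) (hi : i ∈ A) (hij : i ≠ j) :
    lamA r ind (A.erase j) i = lamA r ind A i + ind (A.erase j) i j * lamA r ind A j := by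
  rw [lamA_eq_add_sum_sdiff hr hirr hind (Finset.erase_subset j A)
    (Finset.mem_erase.mpr ⟨hij, hi⟩), Finset.sdiff_erase hj, Finset.sdiff_self,
    insert_empty_eq, Finset.sum_singleton]

theorem isAbsorbing_iff :
    IsAbsorbing r ind A ↔ ∀ j ∉ A, lamA r ind (insert j A) j ≤ 0 := by
  refine ⟨?_, Or.inr⟩
  rintro (rfl | h)
  · simp
  · exact h

/-- A strict superset of an absorbing set has a point of nonpositive drift outside that set. -/
theorem IsAbsorbing.exists_lamA_nonpos (hr : ∀ i j, 0 ≤ r i j) (hirr : IrreducibleRates r)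
    (hind : IsHarmFamily r ind) (hA : IsAbsorbing r ind A) (hAD : A ⊂ D) :
    ∃ j ∈ D \ A, lamA r ind D j ≤ 0 := by
  by_contra! hpos
  obtain ⟨j, hjD, hjA⟩ := Finset.exists_of_ssubset hAD
  have hle := isAbsorbing_iff.mp hA j hjA
  rw [lamA_eq_add_sum_sdiff hr hirr hind (Finset.insert_subset hjD hAD.subset)
    (Finset.mem_insert_self j A)] at hle
  have hsum : 0 ≤ ∑ k ∈ D \ insert j A, ind (insert j A) j k * lamA r ind D k := by
    refine Finset.sum_nonneg fun k hk => mul_nonneg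
      (ind_nonneg hr hirr hind (Finset.mem_insert_self j A) k) (hpos k ?_).le
    simp only [Finset.mem_sdiff, Finset.mem_insert, not_or] at hk ⊢
    exact ⟨hk.1, hk.2.2⟩
  linarith [hpos j (Finset.mem_sdiff.mpr ⟨hjD, hjA⟩)]

/-- Enlarging an absorbing set does not decrease the drift on it. -/
theorem IsAbsorbing.lamA_le (hr : ∀ i j, 0 ≤ r i j) (hirr : IrreducibleRates r)
    (hind : IsHarmFamily r ind) (hA : IsAbsorbing r ind A) (hAD : A ⊆ D) {i : V} (hi : i ∈ A) :
    lamA r ind A i ≤ lamA r ind D i := by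
  induction D using Finset.strongInduction with
  | H D ih =>
    rcases hAD.eq_or_ssubset with rfl | hss
    · rfl
    obtain ⟨j, hj, hle⟩ := hA.exists_lamA_nonpos hr hirr hind hss
    obtain ⟨hjD, hjA⟩ := Finset.mem_sdiff.mp hj
    have hij : i ≠ j := fun h => hjA (h ▸ hi)
    have h1 := ih (D.erase j) (Finset.erase_ssubset hjD) (Finset.subset_erase.mpr ⟨hAD, hjA⟩)
    rw [lamA_erase hr hirr hind hjD (hAD hi) hij] at h1
    have h2 := mul_nonpos_of_nonneg_of_nonpos (ind_nonneg hr hirr hind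
      (Finset.mem_erase.mpr ⟨hij, hAD hi⟩) j) hle
    linarith

/-- An absorbing set with positive drift off `S` lies in every absorbing set containing `S`. -/
theorem IsAbsorbing.subset_of_pos (hr : ∀ i j, 0 ≤ r i j) (hirr : IrreducibleRates r)
    (hind : IsHarmFamily r ind) (hA : IsAbsorbing r ind A)
    (hpos : ∀ i ∈ A \ S, 0 < lamA r ind A i) (hB : IsAbsorbing r ind B) (hSB : S ⊆ B) :
    A ⊆ B := by
  by_contra hAB
  have hss : B ⊂ A ∪ B := Finset.ssubset_iff_subset_ne.mpr
    ⟨Finset.subset_union_right, fun h => hAB (Finset.union_eq_right.mp h.symm)⟩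
  obtain ⟨j, hj, hle⟩ := hB.exists_lamA_nonpos hr hirr hind hss
  rw [Finset.union_sdiff_right, Finset.mem_sdiff] at hj
  have h1 := hA.lamA_le hr hirr hind (Finset.subset_union_left (s₂ := B)) hj.1
  linarith [hpos j (Finset.mem_sdiff.mpr ⟨hj.1, fun h => hj.2 (hSB h)⟩)]

/-- Removing a point of nonpositive drift from an absorbing set leaves an absorbing set. -/
theorem IsAbsorbing.erase (hr : ∀ i j, 0 ≤ r i j) (hirr : IrreducibleRates r)
    (hind : IsHarmFamily r ind) (hA : IsAbsorbing r ind A) {i : V} (hi : i ∈ A)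
    (hle : lamA r ind A i ≤ 0) : IsAbsorbing r ind (A.erase i) := by
  refine isAbsorbing_iff.mpr fun j hj => ?_
  by_cases hji : j = i
  · rwa [hji, Finset.insert_erase hi]
  have hjA : j ∉ A := fun h => hj (Finset.mem_erase.mpr ⟨hji, h⟩)
  have hjI := Finset.mem_insert_self j A
  have hiI := Finset.mem_insert_of_mem (b := j) hi
  have hb := isAbsorbing_iff.mp hA j hjA
  have h1 := lamA_erase hr hirr hind hjI hiI (Ne.symm hji)
  have h2 := lamA_erase hr hirr hind hiI hjI hji
  rw [Finset.erase_insert hjA] at h1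
  rw [Finset.erase_insert_of_ne hji] at h2
  have hp0 := ind_nonneg hr hirr hind hi j
  have hp1 := ind_le_one hr hirr hind hi j
  have hjE := Finset.mem_insert_self j (A.erase i)
  have hq0 := ind_nonneg hr hirr hind hjE i
  have hq1 := ind_le_one hr hirr hind hjE i
  rw [h1] at hle
  rw [h2]
  have hpq := mul_le_one₀ hp1 hq0 hq1
  nlinarith [mul_nonneg hq0 (neg_nonneg.mpr hle),
    mul_nonneg (neg_nonneg.mpr hb) (sub_nonneg.mpr hpq)]

theorem exists_isAbsorbing_pos (hr : ∀ i j, 0 ≤ r i j) (hirr : IrreducibleRates r)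
    (hind : IsHarmFamily r ind) (S : Finset V) :
    ∃ A, IsAbsorbing r ind A ∧ S ⊆ A ∧ ∀ i ∈ A \ S, 0 < lamA r ind A i := by
  obtain ⟨A, hmin⟩ := Set.Finite.exists_minimal
    (s := {A : Finset V | IsAbsorbing r ind A ∧ S ⊆ A}) (Set.toFinite _)
    ⟨univ, Or.inl rfl, Finset.subset_univ S⟩
  obtain ⟨hA, hSA⟩ := hmin.prop
  refine ⟨A, hA, hSA, fun i hi => ?_⟩
  obtain ⟨hiA, hiS⟩ := Finset.mem_sdiff.mp hi
  by_contra! hle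
  exact Finset.notMem_erase i A (hmin.le_of_le
    ⟨hA.erase hr hirr hind hiA hle, Finset.subset_erase.mpr ⟨hSA, hiS⟩⟩
    (Finset.erase_subset i A) hiA)

theorem IsAbsorbing.eq_minAbs (hr : ∀ i j, 0 ≤ r i j) (hirr : IrreducibleRates r)
    (hind : IsHarmFamily r ind) (hA : IsAbsorbing r ind A) (hSA : S ⊆ A)
    (hpos : ∀ i ∈ A \ S, 0 < lamA r ind A i) : A = minAbs r ind S := by
  ext i
  simp only [minAbs, Finset.mem_filter, Finset.mem_univ, true_and]
  exact ⟨fun hi B hB hSB => hA.subset_of_pos hr hirr hind hpos hB hSB hi,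
    fun h => h A hA hSA⟩

end TraceRates

/-- `𝒜(S)`, the intersection of all `r`-absorbing sets containing `S`, is
`r`-absorbing, contains `S`, satisfies `λ^{𝒜(S)}(i) > 0` on `𝒜(S)∖S`, and is the unique
`r`-absorbing set with these properties. -/
theorem minAbs_spec (V : Type*) [Fintype V] [DecidableEq V] [Nonempty V]
    (r : V → V → ℝ) (hr_nonneg : ∀ i j, 0 ≤ r i j) (hr_diag : ∀ i, r i i = 0)
    (hr_irr : IrreducibleRates r)
    (ind : Finset V → V → V → ℝ) (hind : IsHarmFamily r ind)
    (S : Finset V) (hS : S.Nonempty) :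
    IsAbsorbing r ind (minAbs r ind S) ∧ S ⊆ minAbs r ind S ∧
    (∀ i ∈ minAbs r ind S \ S, 0 < lamA r ind (minAbs r ind S) i) ∧
    (∀ A : Finset V, IsAbsorbing r ind A → S ⊆ A →
      (∀ i ∈ A \ S, 0 < lamA r ind A i) → A = minAbs r ind S) := by
  obtain ⟨A, hA, hSA, hpos⟩ := exists_isAbsorbing_pos hr_nonneg hr_irr hind S
  rw [← hA.eq_minAbs hr_nonneg hr_irr hind hSA hpos]
  refine ⟨hA, hSA, hpos, fun B hB hSB hposB => ?_⟩
  rw [hB.eq_minAbs hr_nonneg hr_irr hind hSB hposB,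
    hA.eq_minAbs hr_nonneg hr_irr hind hSA hpos]
end

section
/- For every nonempty A ⊆ V, every w : A → ℝ, and every i ∈ A: ∑_{j∈A} r^A(i,j)(w(j) − w(i)) = ∑_{k∈V} r(i,k)(w^A(k) − w^A(i)), where w^A : V → ℝ is the unique vector that equals w on A and is harmonic at every point of V∖A. -/
open Finset

/-- Maximum principle: a vector that vanishes on a nonempty set and is harmonic elsewhere is
nonpositive. -/
theorem nonpos_of_harmonic_compl {V : Type*} [Fintype V] {r : V → V → ℝ}
    (hr_nonneg : ∀ i j, 0 ≤ r i j) (hr_irr : IrreducibleRates r) {A : Finset V}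
    (hA : A.Nonempty) {u : V → ℝ} (hu_zero : ∀ k ∈ A, u k = 0)
    (hu_harm : ∀ k, k ∉ A → ∑ l, r k l * (u l - u k) = 0) (x : V) : u x ≤ 0 := by
  obtain ⟨a, ha⟩ := hA
  obtain ⟨m, -, hm⟩ := Finset.exists_max_image univ u ⟨a, mem_univ a⟩
  refine (hm x (mem_univ x)).trans ?_
  by_contra! hpos
  have step : ∀ k l, u k = u m → 0 < r k l → u l = u m := by
    intro k l hk hkl
    have hkA : k ∉ A := fun h => by linarith [hu_zero k h]
    have hterm := (Finset.sum_eq_zero_iff_of_nonpos fun l _ =>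
      mul_nonpos_of_nonneg_of_nonpos (hr_nonneg k l)
        (by linarith [hm l (mem_univ l)])).1 (hu_harm k hkA) l (mem_univ l)
    rcases mul_eq_zero.1 hterm with h | h <;> linarith
  have hne : m ≠ a := by
    rintro rfl
    exact hpos.ne' (hu_zero m ha)
  obtain ⟨n, p, hp0, hpn, hp⟩ := hr_irr m a hne
  have hpath : ∀ l ≤ n, u (p l) = u m := by
    intro l
    induction l with
    | zero => intro _; rw [hp0]
    | succ l ih => intro hl; exact step _ _ (ih (by omega)) (hp l (by omega))
  have := hpath n le_rfl
  rw [hpn, hu_zero a ha] at this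
  exact hpos.ne this

/-- A vector that vanishes on a nonempty set and is harmonic elsewhere is zero. -/
theorem eq_zero_of_harmonic_compl {V : Type*} [Fintype V] {r : V → V → ℝ}
    (hr_nonneg : ∀ i j, 0 ≤ r i j) (hr_irr : IrreducibleRates r) {A : Finset V}
    (hA : A.Nonempty) {u : V → ℝ} (hu_zero : ∀ k ∈ A, u k = 0)
    (hu_harm : ∀ k, k ∉ A → ∑ l, r k l * (u l - u k) = 0) (x : V) : u x = 0 := by
  refine le_antisymm (nonpos_of_harmonic_compl hr_nonneg hr_irr hA hu_zero hu_harm x) ?_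
  have h := nonpos_of_harmonic_compl hr_nonneg hr_irr hA (u := fun k => -u k)
    (fun k hk => by simp [hu_zero k hk])
    (fun k hk => by
      rw [← neg_eq_zero, ← Finset.sum_neg_distrib, ← hu_harm k hk]
      exact Finset.sum_congr rfl fun l _ => by ring) x
  linarith

/-- `∑_{j∈A} r^A(i,j)(w(j) − w(i)) = ∑_{k∈V} r(i,k)(w^A(k) − w^A(i))`,
where `w^A` is the harmonic extension of `w` outside `A`. -/
theorem trace_generator_eq (V : Type*) [Fintype V] [DecidableEq V] [Nonempty V]
    (r : V → V → ℝ) (hr_nonneg : ∀ i j, 0 ≤ r i j) (hr_diag : ∀ i, r i i = 0)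
    (hr_irr : IrreducibleRates r)
    (ind : Finset V → V → V → ℝ) (hind : IsHarmFamily r ind)
    (A : Finset V) (hA : A.Nonempty)
    (w wA : V → ℝ)
    (hwA_eq : ∀ i ∈ A, wA i = w i)
    (hwA_harm : ∀ k, k ∉ A → ∑ l, r k l * (wA l - wA k) = 0)
    (i : V) (hi : i ∈ A) :
    ∑ j ∈ A, traceRate r ind A i j * (w j - w i) = ∑ k, r i k * (wA k - wA i) := by
  have hrep : ∀ k, wA k - w i = ∑ j ∈ A, ind A j k * (w j - w i) := by
    intro k
    refine sub_eq_zero.1 (eq_zero_of_harmonic_compl hr_nonneg hr_irr hA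
      (u := fun k => wA k - w i - ∑ j ∈ A, ind A j k * (w j - w i)) ?_ ?_ k)
    · intro k hk
      have : ∑ j ∈ A, ind A j k * (w j - w i) = w k - w i := by
        rw [Finset.sum_eq_single_of_mem k hk, (hind A k hk).1 k hk]
        · simp
        · intro j hj hjk
          simp [(hind A j hj).1 k hk, hjk.symm]
      simp only [this, hwA_eq k hk, sub_self]
    · intro k hk
      have hsum : ∑ l, r k l * ∑ j ∈ A, (ind A j l - ind A j k) * (w j - w i) = 0 := by
        simp_rw [Finset.mul_sum, ← mul_assoc]
        rw [Finset.sum_comm]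
        refine Finset.sum_eq_zero fun j hj => ?_
        rw [← Finset.sum_mul, (hind A j hj).2 k hk, zero_mul]
      rw [← sub_zero (0 : ℝ)]
      nth_rewrite 1 [← hwA_harm k hk]
      rw [← hsum, ← Finset.sum_sub_distrib]
      refine Finset.sum_congr rfl fun l _ => ?_
      simp_rw [sub_mul _ _ (_ - _)]
      rw [Finset.sum_sub_distrib]
      ring
  simp_rw [hwA_eq i hi, hrep, Finset.mul_sum, ← mul_assoc]
  rw [Finset.sum_comm]
  refine Finset.sum_congr rfl fun j hj => ?_
  rw [← Finset.sum_mul]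
  by_cases hij : i = j
  · simp [hij]
  · have hA_part : ∑ k ∈ A, r i k * ind A j k = r i j := by
      rw [Finset.sum_eq_single_of_mem j hj, (hind A j hj).1 j hj]
      · simp
      · intro k hk hkj
        simp [(hind A j hj).1 k hk, hkj]
    rw [traceRate, if_neg hij, ← Finset.sum_add_sum_compl A, hA_part]
end

section
/- Let A and B be subsets of V with ∅ ≠ A ⊊ B ⊆ V. Then λ^A(j) = ∑_{k∈B} λ^B(k)·1^A_j(k) for every j ∈ A. -/
open Finset

/-- The generator `Lw(i) = ∑ₖ r(i,k)(w(k) − w(i))`, as a linear map. -/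
def rateGenerator {V : Type*} [Fintype V] (r : V → V → ℝ) : (V → ℝ) →ₗ[ℝ] (V → ℝ) where
  toFun w i := ∑ k, r i k * (w k - w i)
  map_add' v w := by
    ext i
    simp only [Pi.add_apply, ← Finset.sum_add_distrib]
    exact Finset.sum_congr rfl fun k _ => by ring
  map_smul' c w := by
    ext i
    simp only [Pi.smul_apply, smul_eq_mul, RingHom.id_apply, Finset.mul_sum]
    exact Finset.sum_congr rfl fun k _ => by ring

section

variable {V : Type*} [Fintype V] {r : V → V → ℝ}

theorem rateGenerator_apply (w : V → ℝ) (i : V) :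
    rateGenerator r w i = ∑ k, r i k * (w k - w i) := rfl

/-- Weak maximum principle for functions harmonic off a nonempty set. -/
theorem nonpos_of_harmonic_off (hr_nonneg : ∀ i j, 0 ≤ r i j) (hr_irr : IrreducibleRates r)
    {A : Finset V} (hA : A.Nonempty) {w : V → ℝ} (hwA : ∀ i ∈ A, w i = 0)
    (hw : ∀ i ∉ A, rateGenerator r w i = 0) (i : V) : w i ≤ 0 := by
  obtain ⟨a, ha⟩ := hA
  have : Nonempty V := ⟨a⟩
  obtain ⟨x, hx⟩ := Finite.exists_max w
  refine (hx i).trans ?_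
  by_contra! hpos
  have hxa : x ≠ a := fun h => hpos.ne' (h ▸ hwA a ha)
  obtain ⟨m, k, h0, hm, hk⟩ := hr_irr x a hxa
  have key : ∀ l ≤ m, w (k l) = w x := by
    intro l
    induction l with
    | zero => intro _; rw [h0]
    | succ l ih =>
      intro hl
      have hkl : w (k l) = w x := ih (by omega)
      have hnot : k l ∉ A := fun h => hpos.ne' (hkl ▸ hwA _ h)
      have hsum := hw _ hnot
      rw [rateGenerator_apply, Finset.sum_eq_zero_iff_of_nonpos] at hsum
      · have hz := hsum (k (l + 1)) (Finset.mem_univ _)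
        rcases mul_eq_zero.mp hz with h | h
        · exact absurd h (hk l (by omega)).ne'
        · linarith
      · intro y _
        exact mul_nonpos_of_nonneg_of_nonpos (hr_nonneg _ _) (by linarith [hx y])
  have hend := key m le_rfl
  rw [hm, hwA a ha] at hend
  exact hpos.ne hend

theorem eq_of_harmonic_off_s6 (hr_nonneg : ∀ i j, 0 ≤ r i j) (hr_irr : IrreducibleRates r)
    {A : Finset V} (hA : A.Nonempty) {v w : V → ℝ} (hA_eq : ∀ i ∈ A, v i = w i)
    (hv : ∀ i ∉ A, rateGenerator r v i = 0) (hw : ∀ i ∉ A, rateGenerator r w i = 0) :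
    v = w := by
  ext i
  refine le_antisymm (sub_nonpos.mp ?_) (sub_nonpos.mp ?_)
  · exact nonpos_of_harmonic_off hr_nonneg hr_irr hA (w := v - w)
      (fun i hi => by simp [hA_eq i hi]) (fun i hi => by simp [hv i hi, hw i hi]) i
  · exact nonpos_of_harmonic_off hr_nonneg hr_irr hA (w := w - v)
      (fun i hi => by simp [hA_eq i hi]) (fun i hi => by simp [hv i hi, hw i hi]) i

variable [DecidableEq V] {ind : Finset V → V → V → ℝ}

theorem IsHarmFamily.rateGenerator_eq_zero (hind : IsHarmFamily r ind) {A : Finset V} {j : V}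
    (hj : j ∈ A) {i : V} (hi : i ∉ A) : rateGenerator r (ind A j) i = 0 :=
  (hind A j hj).2 i hi

/-- A function harmonic off `A` is the harmonic extension of its values on `A`. -/
theorem IsHarmFamily.sum_smul_eq (hind : IsHarmFamily r ind) (hr_nonneg : ∀ i j, 0 ≤ r i j)
    (hr_irr : IrreducibleRates r) {A : Finset V} (hA : A.Nonempty) {w : V → ℝ}
    (hw : ∀ i ∉ A, rateGenerator r w i = 0) : ∑ k ∈ A, w k • ind A k = w := by
  refine eq_of_harmonic_off_s6 hr_nonneg hr_irr hA (fun i hi => ?_) (fun i hi => ?_) hw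
  · rw [Finset.sum_apply, Finset.sum_eq_single_of_mem i hi]
    · simp [(hind A i hi).1 i hi]
    · intro k hk hki
      simp [(hind A k hk).1 i hi, hki.symm]
  · rw [map_sum, Finset.sum_apply]
    exact Finset.sum_eq_zero fun k hk => by simp [hind.rateGenerator_eq_zero hk hi]

theorem IsHarmFamily.traceRate_eq (hind : IsHarmFamily r ind) {A : Finset V} {i j : V}
    (hi : i ∈ A) (hj : j ∈ A) (hij : i ≠ j) :
    traceRate r ind A i j = rateGenerator r (ind A j) i := by
  have hA : ∑ k ∈ A, r i k * ind A j k = r i j := by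
    rw [Finset.sum_eq_single_of_mem j hj]
    · simp [(hind A j hj).1 j hj]
    · intro k hk hkj
      simp [(hind A j hj).1 k hk, hkj]
  rw [traceRate, if_neg hij, rateGenerator_apply, (hind A j hj).1 i hi, if_neg hij]
  simp only [sub_zero]
  rw [← Finset.sum_add_sum_compl A, hA]

theorem IsHarmFamily.lamA_eq (hind : IsHarmFamily r ind) (hr_nonneg : ∀ i j, 0 ≤ r i j)
    (hr_irr : IrreducibleRates r) {A : Finset V} {j : V} (hj : j ∈ A) :
    lamA r ind A j = ∑ i, rateGenerator r (ind A j) i := by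
  have hone : rateGenerator r (1 : V → ℝ) = 0 := by
    ext i
    simp [rateGenerator_apply]
  have hrow : ∑ l ∈ A, rateGenerator r (ind A l) j = 0 := by
    have hsum := hind.sum_smul_eq hr_nonneg hr_irr ⟨j, hj⟩ (w := 1) (fun i _ => by simp [hone])
    simp only [Pi.one_apply, one_smul] at hsum
    rw [← Finset.sum_apply, ← map_sum, hsum, hone, Pi.zero_apply]
  have hcol : ∑ i, rateGenerator r (ind A j) i = ∑ i ∈ A, rateGenerator r (ind A j) i :=
    (Finset.sum_subset (Finset.subset_univ A)
      fun i _ hi => hind.rateGenerator_eq_zero hj hi).symm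
  rw [hcol, ← sub_zero (∑ i ∈ A, _), ← hrow, ← Finset.sum_sub_distrib, lamA]
  refine Finset.sum_congr rfl fun i hi => ?_
  by_cases hij : i = j
  · simp [hij]
  · rw [hind.traceRate_eq hi hj hij, hind.traceRate_eq hj hi (Ne.symm hij)]

end

/-- for `∅ ≠ A ⊊ B ⊆ V`, `λ^A(j) = ∑_{k∈B} λ^B(k)·1^A_j(k)` for `j ∈ A`. -/
theorem lamA_eq_sum_lamB (V : Type*) [Fintype V] [DecidableEq V] [Nonempty V]
    (r : V → V → ℝ) (hr_nonneg : ∀ i j, 0 ≤ r i j) (hr_diag : ∀ i, r i i = 0)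
    (hr_irr : IrreducibleRates r)
    (ind : Finset V → V → V → ℝ) (hind : IsHarmFamily r ind)
    (A B : Finset V) (hA : A.Nonempty) (hAB : A ⊂ B)
    (j : V) (hj : j ∈ A) :
    lamA r ind A j = ∑ k ∈ B, lamA r ind B k * ind A j k := by
  have hsum := hind.sum_smul_eq hr_nonneg hr_irr (hA.mono hAB.subset) (w := ind A j)
    fun i hi => hind.rateGenerator_eq_zero hj fun h => hi (hAB.subset h)
  rw [hind.lamA_eq hr_nonneg hr_irr hj]
  conv_lhs => rw [← hsum]
  simp only [map_sum, map_smul, Finset.sum_apply, Pi.smul_apply, smul_eq_mul]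
  rw [Finset.sum_comm]
  refine Finset.sum_congr rfl fun k hk => ?_
  rw [hind.lamA_eq hr_nonneg hr_irr hk, mul_comm, Finset.mul_sum]
end

section
/- For every λ : V → ℝ with ∑_{i∈V} λ(i) = 0 there exist strictly positive reals r(i) > 0, i ∈ V, such that λ = −∑_{i∈V} r(i)·w_i. -/
open Finset

section StationaryMeasures

variable {V : Type*} [Fintype V]

theorem abs_stationary {p : V → V → ℝ} (hp_nonneg : ∀ i j, 0 ≤ p i j)
    (hp_row : ∀ i, ∑ j, p i j = 1) {u : V → ℝ} (hu : ∀ j, ∑ i, u i * p i j = u j) (j : V) :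
    ∑ i, |u i| * p i j = |u j| := by
  have hle : ∀ j ∈ univ, |u j| ≤ ∑ i, |u i| * p i j := fun j _ => by
    rw [← hu j]
    refine (abs_sum_le_sum_abs _ _).trans_eq (sum_congr rfl fun i _ => ?_)
    rw [abs_mul, abs_of_nonneg (hp_nonneg i j)]
  have hsum : ∑ j, |u j| = ∑ j, ∑ i, |u i| * p i j := by
    rw [sum_comm]
    simp [← mul_sum, hp_row]
  exact ((sum_eq_sum_iff_of_le hle).1 hsum j (mem_univ j)).symm

theorem IrreducibleRates.pos_of_stationary {p : V → V → ℝ} (hp_irr : IrreducibleRates p)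
    (hp_nonneg : ∀ i j, 0 ≤ p i j) {v : V → ℝ} (hv_nonneg : ∀ i, 0 ≤ v i)
    (hv : ∀ j, ∑ i, v i * p i j = v j) {i : V} (hi : 0 < v i) (j : V) : 0 < v j := by
  rcases eq_or_ne i j with rfl | hij
  · exact hi
  obtain ⟨m, k, rfl, rfl, hk⟩ := hp_irr i j hij
  have hpath : ∀ l ≤ m, 0 < v (k l) := by
    intro l
    induction l with
    | zero => exact fun _ => hi
    | succ l ih =>
      intro hl
      rw [← hv]
      exact (mul_pos (ih (by omega)) (hk l (by omega))).trans_le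
        (single_le_sum (f := fun i => v i * p i (k (l + 1)))
          (fun i _ => mul_nonneg (hv_nonneg i) (hp_nonneg i _)) (mem_univ _))
  exact hpath m le_rfl

theorem IrreducibleRates.nonpos_or_pos_of_stationary {p : V → V → ℝ}
    (hp_irr : IrreducibleRates p) (hp_nonneg : ∀ i j, 0 ≤ p i j)
    (hp_row : ∀ i, ∑ j, p i j = 1) {u : V → ℝ} (hu : ∀ j, ∑ i, u i * p i j = u j) :
    (∀ i, u i ≤ 0) ∨ ∀ i, 0 < u i := by
  refine or_iff_not_imp_left.2 fun h j => ?_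
  push Not at h
  obtain ⟨i, hi⟩ := h
  have hpos : 0 < u j + |u j| :=
    hp_irr.pos_of_stationary (v := fun i => u i + |u i|) hp_nonneg
      (fun i => by linarith [neg_abs_le (u i)])
      (fun j => by simp only [add_mul, sum_add_distrib, hu, abs_stationary hp_nonneg hp_row hu])
      (add_pos hi (abs_pos.2 hi.ne')) j
  by_contra! hj
  rw [abs_of_nonpos hj] at hpos
  linarith

/-- The map `u ↦ u P - u + (∑ i, u i) 1`, for row vectors `u`. -/
def stationaryMap (p : V → V → ℝ) : (V → ℝ) →ₗ[ℝ] (V → ℝ) where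
  toFun u j := ∑ i, u i * p i j - u j + ∑ i, u i
  map_add' u v := by
    ext j
    simp only [Pi.add_apply, add_mul, sum_add_distrib]
    ring
  map_smul' c u := by
    ext j
    simp only [Pi.smul_apply, smul_eq_mul, mul_assoc, ← mul_sum, RingHom.id_apply]
    ring

theorem stationaryMap_apply (p : V → V → ℝ) (u : V → ℝ) (j : V) :
    stationaryMap p u j = ∑ i, u i * p i j - u j + ∑ i, u i := rfl

theorem sum_stationaryMap {p : V → V → ℝ} (hp_row : ∀ i, ∑ j, p i j = 1) (u : V → ℝ) :
    ∑ j, stationaryMap p u j = Fintype.card V * ∑ i, u i := by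
  simp only [stationaryMap_apply, sum_add_distrib, sum_sub_distrib]
  rw [sum_comm]
  simp [← mul_sum, hp_row]

variable [Nonempty V]

theorem IrreducibleRates.stationaryMap_surjective {p : V → V → ℝ}
    (hp_irr : IrreducibleRates p) (hp_nonneg : ∀ i j, 0 ≤ p i j)
    (hp_row : ∀ i, ∑ j, p i j = 1) : Function.Surjective (stationaryMap p) := by
  refine LinearMap.injective_iff_surjective.1 ((injective_iff_map_eq_zero _).2 fun u hu => ?_)
  have hsum : ∑ i, u i = 0 := by
    have h := sum_stationaryMap hp_row u
    simpa [hu] using h.symm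
  have hstat : ∀ j, ∑ i, u i * p i j = u j := fun j => by
    have h := congrFun hu j
    rw [stationaryMap_apply, hsum, Pi.zero_apply] at h
    linarith
  rcases hp_irr.nonpos_or_pos_of_stationary hp_nonneg hp_row hstat with h | h
  · exact funext fun i => (sum_eq_zero_iff_of_nonpos fun i _ => h i).1 hsum i (mem_univ i)
  · exact absurd hsum (sum_pos (fun i _ => h i) univ_nonempty).ne'

theorem IrreducibleRates.exists_pos_stationary {p : V → V → ℝ}
    (hp_irr : IrreducibleRates p) (hp_nonneg : ∀ i j, 0 ≤ p i j)
    (hp_row : ∀ i, ∑ j, p i j = 1) :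
    ∃ π : V → ℝ, (∀ i, 0 < π i) ∧ ∀ j, ∑ i, π i * p i j = π j := by
  obtain ⟨π, hπ⟩ := hp_irr.stationaryMap_surjective hp_nonneg hp_row 1
  have hsum : ∑ i, π i = 1 := by
    have h := sum_stationaryMap hp_row π
    simpa [hπ] using h.symm
  have hstat : ∀ j, ∑ i, π i * p i j = π j := fun j => by
    have h := congrFun hπ j
    rw [stationaryMap_apply, hsum, Pi.one_apply] at h
    linarith
  refine ⟨π, ?_, hstat⟩
  refine (hp_irr.nonpos_or_pos_of_stationary hp_nonneg hp_row hstat).resolve_left fun h => ?_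
  linarith [sum_nonpos fun i (_ : i ∈ univ) => h i]

end StationaryMeasures

theorem exists_forall_add_mul_pos {ι : Type*} [Fintype ι] (u : ι → ℝ) {π : ι → ℝ}
    (hπ : ∀ i, 0 < π i) : ∃ c : ℝ, ∀ i, 0 < u i + c * π i := by
  refine ⟨∑ i, |u i| / π i + 1, fun i => ?_⟩
  have h : |u i| / π i ≤ ∑ i, |u i| / π i :=
    single_le_sum (f := fun i => |u i| / π i)
      (fun i _ => div_nonneg (abs_nonneg _) (hπ i).le) (mem_univ i)
  rw [div_le_iff₀ (hπ i)] at h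
  linarith [neg_abs_le (u i), hπ i]

/-- for every `λ` with `∑_i λ(i) = 0` there are `r(i) > 0` with
`λ = −∑_i r(i)·w_i`, where `w_i = ∑_j p(i,j)(1_{i} − 1_{j})`. -/
theorem exists_positive_rates (V : Type*) [Fintype V] [DecidableEq V] [Nonempty V]
    (p : V → V → ℝ) (hp_nonneg : ∀ i j, 0 ≤ p i j) (hp_diag : ∀ i, p i i = 0)
    (hp_row : ∀ i, ∑ j, p i j = 1) (hp_irr : IrreducibleRates p)
    (lam : V → ℝ) (hlam : ∑ i, lam i = 0) :
    ∃ rr : V → ℝ, (∀ i, 0 < rr i) ∧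
      ∀ j, lam j = -∑ i, rr i *
        (∑ k, p i k * ((if j = i then (1 : ℝ) else 0) - (if j = k then (1 : ℝ) else 0))) := by
  obtain ⟨π, hπ_pos, hπ⟩ := hp_irr.exists_pos_stationary hp_nonneg hp_row
  obtain ⟨u, hu⟩ := hp_irr.stationaryMap_surjective hp_nonneg hp_row lam
  have hsum : ∑ i, u i = 0 := by
    have h := sum_stationaryMap hp_row u
    simpa [hu, hlam] using h.symm
  obtain ⟨c, hc⟩ := exists_forall_add_mul_pos u hπ_pos
  refine ⟨fun i => u i + c * π i, hc, fun j => ?_⟩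
  have hj : lam j = ∑ i, u i * p i j - u j := by
    rw [← hu, stationaryMap_apply, hsum, add_zero]
  have hw : ∀ i, ∑ k, p i k * ((if j = i then (1 : ℝ) else 0) - (if j = k then (1 : ℝ) else 0))
      = (if j = i then (1 : ℝ) else 0) - p i j := fun i => by
    simp only [mul_sub, sum_sub_distrib, ← sum_mul, hp_row, one_mul]
    simp
  simp only [hw]
  simp only [mul_sub, sum_sub_distrib, add_mul, mul_assoc, sum_add_distrib, ← mul_sum, hπ, hj]
  simp
end

section
/- For every nonempty B ⊆ V and every j ∈ B: ∑_{i∈B} μ(i)·r^B(i,j) = μ(j)·∑_{i∈B} r^B(j,i); that is, the invariant distribution μ of r, restricted to B, is invariant for the trace rates r^B. -/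
open Finset

/-- Maximum principle: a vector which vanishes on a nonempty set and is harmonic elsewhere is
nonpositive. -/
theorem IrreducibleRates.nonpos_of_harmonic {V : Type*} [Fintype V]
    {r : V → V → ℝ} (hr_nonneg : ∀ i j, 0 ≤ r i j) (hr_irr : IrreducibleRates r)
    {B : Finset V} (hB : B.Nonempty) {h : V → ℝ} (h_zero : ∀ i ∈ B, h i = 0)
    (h_harm : ∀ k, k ∉ B → ∑ l, r k l * (h l - h k) = 0) (i : V) : h i ≤ 0 := by
  obtain ⟨b, hb⟩ := hB
  obtain ⟨x, -, hx⟩ := Finset.exists_max_image Finset.univ h ⟨b, Finset.mem_univ b⟩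
  refine (hx i (Finset.mem_univ i)).trans ?_
  by_contra! hpos
  have hne : x ≠ b := by
    rintro rfl
    exact hpos.ne' (h_zero x hb)
  obtain ⟨m, p, hp_zero, hp_end, hp⟩ := hr_irr x b hne
  have hconst : ∀ l ≤ m, h (p l) = h x := by
    intro l
    induction l with
    | zero => intro _; rw [hp_zero]
    | succ l ih =>
      intro hl
      have hpl := ih (by omega)
      have hmem : p l ∉ B := fun hB => hpos.ne' (hpl ▸ h_zero _ hB)
      have hterms := (Finset.sum_eq_zero_iff_of_nonpos fun y _ =>
        mul_nonpos_of_nonneg_of_nonpos (hr_nonneg (p l) y)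
          (by have := hx y (Finset.mem_univ y); linarith)).1 (h_harm (p l) hmem)
      have hstep := hterms (p (l + 1)) (Finset.mem_univ _)
      have := (mul_eq_zero.1 hstep).resolve_left (hp l (by omega)).ne'
      linarith
  have := hconst m le_rfl
  rw [hp_end, h_zero b hb] at this
  exact hpos.ne this

/-- A vector which vanishes on a nonempty set and is harmonic elsewhere is zero. -/
theorem IrreducibleRates.eq_zero_of_harmonic {V : Type*} [Fintype V]
    {r : V → V → ℝ} (hr_nonneg : ∀ i j, 0 ≤ r i j) (hr_irr : IrreducibleRates r)
    {B : Finset V} (hB : B.Nonempty) {h : V → ℝ} (h_zero : ∀ i ∈ B, h i = 0)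
    (h_harm : ∀ k, k ∉ B → ∑ l, r k l * (h l - h k) = 0) (i : V) : h i = 0 := by
  refine le_antisymm (hr_irr.nonpos_of_harmonic hr_nonneg hB h_zero h_harm i) ?_
  have := hr_irr.nonpos_of_harmonic hr_nonneg hB (h := fun k => -h k)
    (fun k hk => by simp [h_zero k hk])
    (fun k hk => by
      rw [← neg_eq_zero, ← Finset.sum_neg_distrib, ← h_harm k hk]
      exact Finset.sum_congr rfl fun l _ => by ring) i
  linarith

/-- The harmonic extensions of the point indicators of `B` form a partition of unity. -/
theorem IsHarmFamily.sum_eq_one_s8 {V : Type*} [Fintype V] [DecidableEq V]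
    {r : V → V → ℝ} (hr_nonneg : ∀ i j, 0 ≤ r i j) (hr_irr : IrreducibleRates r)
    {ind : Finset V → V → V → ℝ} (hind : IsHarmFamily r ind)
    {B : Finset V} (hB : B.Nonempty) (k : V) : ∑ i ∈ B, ind B i k = 1 := by
  have := hr_irr.eq_zero_of_harmonic hr_nonneg hB (h := fun k => ∑ i ∈ B, ind B i k - 1)
    (fun i hi => by
      rw [Finset.sum_congr rfl fun j hj => (hind B j hj).1 i hi]
      simp [hi])
    (fun k hk => by
      simp only [sub_sub_sub_cancel_right, ← Finset.sum_sub_distrib, Finset.mul_sum]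
      rw [Finset.sum_comm]
      exact Finset.sum_eq_zero fun i hi => (hind B i hi).2 k hk) k
  linarith

/-- Off the diagonal, the trace rates are the sums of the rates against the harmonic
extensions. -/
theorem IsHarmFamily.traceRate_eq_s8 {V : Type*} [Fintype V] [DecidableEq V]
    {r : V → V → ℝ} {ind : Finset V → V → V → ℝ} (hind : IsHarmFamily r ind)
    {B : Finset V} {i j : V} (hj : j ∈ B) :
    traceRate r ind B i j = if i = j then 0 else ∑ k, r i k * ind B j k := by
  have hsum : ∑ k ∈ B, r i k * ind B j k = r i j := by
    rw [Finset.sum_congr rfl fun k hk => by rw [(hind B j hj).1 k hk]]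
    simp [hj]
  rw [traceRate, ← Finset.sum_add_sum_compl B fun k => r i k * ind B j k, hsum]

/-- The total trace rate out of `j` is minus the generator applied to the harmonic extension of
the indicator of `j`. -/
theorem IsHarmFamily.sum_traceRate {V : Type*} [Fintype V] [DecidableEq V]
    {r : V → V → ℝ} (hr_nonneg : ∀ i j, 0 ≤ r i j) (hr_irr : IrreducibleRates r)
    {ind : Finset V → V → V → ℝ} (hind : IsHarmFamily r ind)
    {B : Finset V} {j : V} (hj : j ∈ B) :
    ∑ i ∈ B, traceRate r ind B j i = -∑ k, r j k * (ind B j k - ind B j j) := by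
  have htotal : ∑ i ∈ B, ∑ k, r j k * ind B i k = ∑ k, r j k := by
    rw [Finset.sum_comm]
    simp_rw [← Finset.mul_sum, hind.sum_eq_one_s8 hr_nonneg hr_irr ⟨j, hj⟩, mul_one]
  rw [← Finset.add_sum_erase B _ hj] at htotal ⊢
  rw [Finset.sum_congr rfl fun i hi => by
    rw [hind.traceRate_eq_s8 (Finset.mem_of_mem_erase hi), if_neg (Finset.ne_of_mem_erase hi).symm]]
  simp only [traceRate, if_pos, (hind B j hj).1 j hj, mul_sub, mul_one, Finset.sum_sub_distrib]
  linarith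

/-- An invariant vector annihilates the image of the generator. -/
theorem sum_mul_generator_eq_zero {V : Type*} [Fintype V] {r : V → V → ℝ} {μ : V → ℝ}
    (hμ_inv : ∀ j, ∑ i, (μ i * r i j - μ j * r j i) = 0) (w : V → ℝ) :
    ∑ i, μ i * ∑ k, r i k * (w k - w i) = 0 := by
  have hsum : ∑ j, w j * ∑ i, (μ i * r i j - μ j * r j i) = 0 := by simp [hμ_inv]
  simp only [Finset.mul_sum, mul_sub, Finset.sum_sub_distrib] at hsum ⊢
  rw [Finset.sum_comm] at hsum
  rw [← hsum]
  congr 1 <;> exact Finset.sum_congr rfl fun i _ => Finset.sum_congr rfl fun k _ => by ring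

/-- the invariant distribution `μ` of `r` is invariant for the trace rates
`r^B`: `∑_{i∈B} μ(i)·r^B(i,j) = μ(j)·∑_{i∈B} r^B(j,i)` for every `j ∈ B`. -/
theorem invariant_for_trace (V : Type*) [Fintype V] [DecidableEq V] [Nonempty V]
    (r : V → V → ℝ) (hr_nonneg : ∀ i j, 0 ≤ r i j) (hr_diag : ∀ i, r i i = 0)
    (hr_irr : IrreducibleRates r)
    (ind : Finset V → V → V → ℝ) (hind : IsHarmFamily r ind)
    (μ : V → ℝ) (hμ_pos : ∀ i, 0 < μ i) (hμ_sum : ∑ i, μ i = 1)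
    (hμ_inv : ∀ j, ∑ i, (μ i * r i j - μ j * r j i) = 0)
    (B : Finset V) (hB : B.Nonempty) (j : V) (hj : j ∈ B) :
    ∑ i ∈ B, μ i * traceRate r ind B i j = μ j * ∑ i ∈ B, traceRate r ind B j i := by
  have hgen := sum_mul_generator_eq_zero hμ_inv (ind B j)
  rw [← Finset.sum_add_sum_compl B, Finset.sum_eq_zero (s := Bᶜ) fun i hi => by
    rw [(hind B j hj).2 i (Finset.mem_compl.1 hi), mul_zero], add_zero,
    ← Finset.add_sum_erase B _ hj] at hgen
  rw [hind.sum_traceRate hr_nonneg hr_irr hj, ← Finset.add_sum_erase B _ hj,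
    Finset.sum_congr rfl fun i hi => by
      rw [hind.traceRate_eq_s8 hj, if_neg (Finset.ne_of_mem_erase hi)]]
  rw [Finset.sum_congr (s₁ := B.erase j) rfl fun i hi => by
    rw [(hind B j hj).1 i (Finset.mem_of_mem_erase hi),
      if_neg (Finset.ne_of_mem_erase hi)]] at hgen
  simp only [sub_zero] at hgen
  simp only [traceRate, if_pos]
  linarith
end

section
/- For every nonempty B ⊆ V the following are equivalent: (i) λ^B(i) = 0 for every i ∈ B; (ii) μ is constant on B, i.e. μ(i) = μ(j) for all i, j ∈ B. -/
open Finset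

section TraceProcess

variable {V : Type*} [Fintype V]

/-- The generator `Lw(i) = ∑_k r(i,k)(w(k) − w(i))`. -/
def rateGen (r : V → V → ℝ) (w : V → ℝ) (i : V) : ℝ :=
  ∑ k, r i k * (w k - w i)

lemma rateGen_neg (r : V → V → ℝ) (w : V → ℝ) (i : V) :
    rateGen r (fun k => -w k) i = -rateGen r w i := by
  unfold rateGen
  rw [← sum_neg_distrib]
  exact sum_congr rfl fun k _ => by ring

lemma rateGen_sum (r : V → V → ℝ) {ι : Type*} (s : Finset ι) (f : ι → V → ℝ) (i : V) :
    rateGen r (fun k => ∑ j ∈ s, f j k) i = ∑ j ∈ s, rateGen r (f j) i := by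
  unfold rateGen
  rw [sum_comm]
  exact sum_congr rfl fun k _ => by rw [← sum_sub_distrib, mul_sum]

/-- An invariant measure annihilates the range of the generator. -/
lemma sum_mul_rateGen_eq_zero {r : V → V → ℝ} {μ : V → ℝ}
    (hμ : ∀ j, ∑ i, (μ i * r i j - μ j * r j i) = 0) (w : V → ℝ) :
    ∑ i, μ i * rateGen r w i = 0 := by
  have h : ∑ j, w j * ∑ i, (μ i * r i j - μ j * r j i) = 0 := by simp [hμ]
  have h₁ : ∑ i, ∑ j, w j * (μ i * r i j) = ∑ j, ∑ i, w j * (μ i * r i j) := sum_comm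
  simp only [mul_sum, mul_sub, sum_sub_distrib] at h
  simp only [rateGen, mul_sum, mul_sub, sum_sub_distrib]
  rw [← h, ← h₁]
  congr 1 <;> exact sum_congr rfl fun i _ => sum_congr rfl fun j _ => by ring

/-- Maximum principle: a vector harmonic off a nonempty set `A` is bounded by its bound on `A`. -/
lemma le_of_harmonic_off {r : V → V → ℝ} (hr : ∀ i j, 0 ≤ r i j) (hirr : IrreducibleRates r)
    {A : Finset V} (hA : A.Nonempty) {w : V → ℝ} (hw : ∀ k ∉ A, rateGen r w k = 0) {c : ℝ}
    (hc : ∀ a ∈ A, w a ≤ c) (i : V) : w i ≤ c := by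
  obtain ⟨a, ha⟩ := hA
  obtain ⟨m, -, hm⟩ := exists_max_image univ w ⟨a, mem_univ a⟩
  by_contra! hi
  have hcm : c < w m := hi.trans_le (hm i (mem_univ i))
  have step : ∀ k l, w k = w m → 0 < r k l → w l = w m := by
    intro k l hk hkl
    have hkA : k ∉ A := fun h => absurd (hc k h) (by linarith)
    have hterm : ∀ j ∈ univ, 0 ≤ r k j * (w k - w j) := fun j hj =>
      mul_nonneg (hr k j) (by linarith [hm j hj])
    have hsum : ∑ j, r k j * (w k - w j) = 0 := by
      have := hw k hkA
      rw [← neg_eq_zero, ← this, rateGen, ← sum_neg_distrib]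
      exact sum_congr rfl fun j _ => by ring
    have := (sum_eq_zero_iff_of_nonneg hterm).1 hsum l (mem_univ l)
    rcases mul_eq_zero.1 this with h | h <;> linarith
  have hma : m ≠ a := by
    rintro rfl
    exact absurd (hc m ha) (by linarith)
  obtain ⟨n, p, hp0, hpn, hp⟩ := hirr m a hma
  have hpath : ∀ l ≤ n, w (p l) = w m := by
    intro l
    induction l with
    | zero => intro _; rw [hp0]
    | succ l ih => intro hl; exact step _ _ (ih (by omega)) (hp l (by omega))
  have := hpath n le_rfl
  rw [hpn] at this
  linarith [hc a ha]

lemma eq_const_of_harmonic_off {r : V → V → ℝ} (hr : ∀ i j, 0 ≤ r i j)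
    (hirr : IrreducibleRates r) {A : Finset V} (hA : A.Nonempty) {w : V → ℝ}
    (hw : ∀ k ∉ A, rateGen r w k = 0) {c : ℝ} (hc : ∀ a ∈ A, w a = c) (i : V) : w i = c := by
  refine le_antisymm (le_of_harmonic_off hr hirr hA hw (fun a ha => (hc a ha).le) i) ?_
  refine neg_le_neg_iff.1 (le_of_harmonic_off hr hirr hA (w := fun k => -w k) (fun k hk => ?_)
    (fun a ha => neg_le_neg (hc a ha).ge) i)
  rw [rateGen_neg, hw k hk, neg_zero]

variable [DecidableEq V] {r : V → V → ℝ} {ind : Finset V → V → V → ℝ} {B : Finset V}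

lemma harmFamily_nonneg (hr : ∀ i j, 0 ≤ r i j) (hirr : IrreducibleRates r)
    (hind : IsHarmFamily r ind) {j : V} (hj : j ∈ B) (k : V) : 0 ≤ ind B j k := by
  refine neg_nonpos.1 (le_of_harmonic_off hr hirr ⟨j, hj⟩ (w := fun k => -ind B j k)
    (fun k hk => ?_) (fun a ha => ?_) k)
  · rw [rateGen_neg, rateGen, (hind B j hj).2 k hk, neg_zero]
  · rw [(hind B j hj).1 a ha]
    split_ifs <;> norm_num

lemma sum_harmFamily_apply (hind : IsHarmFamily r ind) {Z : Finset V} (hZ : Z ⊆ B) {a : V}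
    (ha : a ∈ B) : ∑ j ∈ Z, ind B j a = if a ∈ Z then 1 else 0 := by
  rw [sum_congr rfl fun j hj => (hind B j (hZ hj)).1 a ha, sum_ite_eq]

lemma sum_harmFamily_eq_one (hr : ∀ i j, 0 ≤ r i j) (hirr : IrreducibleRates r)
    (hind : IsHarmFamily r ind) (hB : B.Nonempty) (k : V) : ∑ j ∈ B, ind B j k = 1 := by
  refine eq_const_of_harmonic_off hr hirr hB (w := fun k => ∑ j ∈ B, ind B j k)
    (fun k hk => ?_) (fun a ha => ?_) k
  · rw [rateGen_sum]
    exact sum_eq_zero fun j hj => (hind B j hj).2 k hk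
  · simpa [ha] using sum_harmFamily_apply hind Subset.rfl ha

lemma sum_rateGen_harmFamily (hr : ∀ i j, 0 ≤ r i j) (hirr : IrreducibleRates r)
    (hind : IsHarmFamily r ind) (hB : B.Nonempty) (i : V) :
    ∑ j ∈ B, rateGen r (ind B j) i = 0 := by
  rw [← rateGen_sum]
  simp [rateGen, sum_harmFamily_eq_one hr hirr hind hB]

lemma rateGen_harmFamily_of_ne (hind : IsHarmFamily r ind) {i j : V} (hi : i ∈ B) (hj : j ∈ B)
    (hij : i ≠ j) : rateGen r (ind B j) i = ∑ k, r i k * ind B j k := by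
  simp [rateGen, (hind B j hj).1 i hi, hij]

lemma traceRate_eq_rateGen (hind : IsHarmFamily r ind) {i j : V} (hi : i ∈ B) (hj : j ∈ B)
    (hij : i ≠ j) : traceRate r ind B i j = rateGen r (ind B j) i := by
  rw [rateGen_harmFamily_of_ne hind hi hj hij, traceRate, if_neg hij, ← sum_add_sum_compl B]
  have h : ∑ k ∈ B, r i k * ind B j k = ∑ k ∈ B, r i k * if k = j then 1 else 0 :=
    sum_congr rfl fun k hk => by rw [(hind B j hj).1 k hk]
  rw [h]
  simp [hj]

lemma rateGen_harmFamily_nonneg (hr : ∀ i j, 0 ≤ r i j) (hirr : IrreducibleRates r)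
    (hind : IsHarmFamily r ind) {i j : V} (hi : i ∈ B) (hj : j ∈ B) (hij : i ≠ j) :
    0 ≤ rateGen r (ind B j) i := by
  rw [rateGen_harmFamily_of_ne hind hi hj hij]
  exact sum_nonneg fun k _ => mul_nonneg (hr i k) (harmFamily_nonneg hr hirr hind hj k)

lemma lamA_eq_sum_rateGen (hr : ∀ i j, 0 ≤ r i j) (hirr : IrreducibleRates r)
    (hind : IsHarmFamily r ind) {j : V} (hj : j ∈ B) :
    lamA r ind B j = ∑ i ∈ B, rateGen r (ind B j) i := by
  have h : lamA r ind B j =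
      ∑ i ∈ B, (rateGen r (ind B j) i - rateGen r (ind B i) j) := by
    refine sum_congr rfl fun i hi => ?_
    rcases eq_or_ne i j with rfl | hij
    · simp
    · rw [traceRate_eq_rateGen hind hi hj hij, traceRate_eq_rateGen hind hj hi hij.symm]
  rw [h, sum_sub_distrib, sum_rateGen_harmFamily hr hirr hind ⟨j, hj⟩, sub_zero]

lemma sum_mul_rateGen_harmFamily (hind : IsHarmFamily r ind) {μ : V → ℝ}
    (hμ : ∀ j, ∑ i, (μ i * r i j - μ j * r j i) = 0) {j : V} (hj : j ∈ B) :
    ∑ i ∈ B, μ i * rateGen r (ind B j) i = 0 := by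
  rw [← sum_mul_rateGen_eq_zero hμ (ind B j)]
  refine sum_subset (subset_univ B) fun i _ hi => ?_
  rw [rateGen, (hind B j hj).2 i hi, mul_zero]

/-- A nonnegative invariant vector of the trace process vanishing at one point of `B` vanishes
on `B`. -/
lemma eq_zero_of_sum_mul_rateGen_harmFamily (hr : ∀ i j, 0 ≤ r i j) (hirr : IrreducibleRates r)
    (hind : IsHarmFamily r ind) {ν : V → ℝ} (hν : ∀ i ∈ B, 0 ≤ ν i)
    (hinv : ∀ j ∈ B, ∑ i ∈ B, ν i * rateGen r (ind B j) i = 0)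
    {b : V} (hb : b ∈ B) (hνb : ν b = 0) {i : V} (hi : i ∈ B) : ν i = 0 := by
  classical
  set Z := B.filter fun j => ν j = 0
  have hZB : Z ⊆ B := filter_subset _ _
  have hbZ : b ∈ Z := mem_filter.2 ⟨hb, hνb⟩
  have hone : ∑ j ∈ Z, ind B j i = 1 := by
    refine eq_const_of_harmonic_off hr hirr ⟨b, hbZ⟩
      (w := fun k => ∑ j ∈ Z, ind B j k) (fun k hk => ?_) (fun a ha => ?_) i
    · rw [rateGen_sum]
      refine sum_eq_zero fun j hj => ?_
      obtain ⟨hjB, hνj⟩ := mem_filter.1 hj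
      by_cases hkB : k ∈ B
      · have hterm : ∀ l ∈ B, 0 ≤ ν l * rateGen r (ind B j) l := by
          intro l hl
          rcases eq_or_ne l j with rfl | hlj
          · simp [hνj]
          · exact mul_nonneg (hν l hl) (rateGen_harmFamily_nonneg hr hirr hind hl hjB hlj)
        have := (sum_eq_zero_iff_of_nonneg hterm).1 (hinv j hjB) k hkB
        exact (mul_eq_zero.1 this).resolve_left fun h => hk (mem_filter.2 ⟨hkB, h⟩)
      · exact (hind B j hjB).2 k hkB
    · simpa [ha] using sum_harmFamily_apply hind hZB (hZB ha)
  rw [sum_harmFamily_apply hind hZB hi] at hone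
  by_contra h
  have hiZ : i ∉ Z := fun hiZ => h (mem_filter.1 hiZ).2
  simp [hiZ] at hone

end TraceProcess

/-- `λ^B ≡ 0` on `B` iff `μ` is constant on `B`. -/
theorem lamB_null_iff_mu_const (V : Type*) [Fintype V] [DecidableEq V] [Nonempty V]
    (r : V → V → ℝ) (hr_nonneg : ∀ i j, 0 ≤ r i j) (hr_diag : ∀ i, r i i = 0)
    (hr_irr : IrreducibleRates r)
    (ind : Finset V → V → V → ℝ) (hind : IsHarmFamily r ind)
    (μ : V → ℝ) (hμ_pos : ∀ i, 0 < μ i) (hμ_sum : ∑ i, μ i = 1)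
    (hμ_inv : ∀ j, ∑ i, (μ i * r i j - μ j * r j i) = 0)
    (B : Finset V) (hB : B.Nonempty) :
    (∀ i ∈ B, lamA r ind B i = 0) ↔ (∀ i ∈ B, ∀ j ∈ B, μ i = μ j) := by
  constructor
  · intro hlam
    obtain ⟨b, hb, hmin⟩ := exists_min_image B μ hB
    have key : ∀ i ∈ B, μ i - μ b = 0 := fun i hi =>
      eq_zero_of_sum_mul_rateGen_harmFamily hr_nonneg hr_irr hind (ν := fun k => μ k - μ b)
        (fun k hk => sub_nonneg.2 (hmin k hk))
        (fun j hj => by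
          simp only [sub_mul]
          rw [sum_sub_distrib, sum_mul_rateGen_harmFamily hind hμ_inv hj, ← mul_sum,
            ← lamA_eq_sum_rateGen hr_nonneg hr_irr hind hj, hlam j hj, mul_zero, sub_zero])
        hb (sub_self _) hi
    intro i hi j hj
    linarith [key i hi, key j hj]
  · intro hconst j hj
    have h := sum_mul_rateGen_harmFamily hind hμ_inv hj
    rw [sum_congr rfl fun i hi => by rw [hconst i hi j hj], ← mul_sum,
      ← lamA_eq_sum_rateGen hr_nonneg hr_irr hind hj] at h
    exact (mul_eq_zero.1 h).resolve_left (hμ_pos j).ne'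
end
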